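/- For every d ≥ 0, let p = e · g(3) · g(f(3)) · … · g(f^d(3)) and let s = g(f^{d-1}(01203)) · g(f^{d-2}(01203)) · … · g(f(01203)) · g(01203) · abcdeacdb (where the product of g-images in s is empty when d = 0). Then the word T = p·s is a conjugate of g(f^d(23)) and T is not a factor of w₅ = G(F^ω(0)). -/

import Mathlib

/-- The morphism F on the alphabet Σ = {0,1,2,3,4}. -/
def F : Fin 5 → List (Fin 5)
  | 0 => [0, 1]
  | 1 => [2]
  | 2 => [0, 3]
  | 3 => [2, 4]
  | 4 => [2, 3]

/-- Extension of F to words. -/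
def Fw (w : List (Fin 5)) : List (Fin 5) := w.flatMap F

/-- `u` is a factor of the fixed point F^ω(0). -/
def FactorF (u : List (Fin 5)) : Prop := ∃ n, u <:+: Fw^[n] [0]

/-- `v` is a conjugate (cyclic rotation) of `u`. -/
def Conj (u v : List (Fin 5)) : Prop := ∃ s t, u = s ++ t ∧ v = t ++ s

/-- The morphism G : Σ* → Δ*, where Δ = {a,b,c,d,e} is coded as
`a = 0, b = 1, c = 2, d = 3, e = 4`. -/
def G : Fin 5 → List (Fin 5)
  | 0 => [0, 1, 2, 3]      -- abcd
  | 1 => []                -- ε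
  | 2 => [4, 0, 2, 3]      -- eacd
  | 3 => [1, 4, 2, 3]      -- becd
  | 4 => [1, 4]            -- be

/-- Extension of G to words. -/
def Gw (w : List (Fin 5)) : List (Fin 5) := w.flatMap G

/-- `u` is a factor of w₅ = G(F^ω(0)). -/
def FactorW5 (u : List (Fin 5)) : Prop := ∃ n, u <:+: Gw (Fw^[n] [0])

/-- The morphism f = F³ on words. -/
def fword (w : List (Fin 5)) : List (Fin 5) := Fw (Fw (Fw w))

/-- The morphism g = G ∘ F² on words. -/
def gword (w : List (Fin 5)) : List (Fin 5) := Gw (Fw (Fw w))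

/-- g(f^k(w)). -/
def gf (k : ℕ) (w : List (Fin 5)) : List (Fin 5) := gword (fword^[k] w)

/-- p = e · g(3) · g(f(3)) · … · g(f^d(3)). -/
def p23 (d : ℕ) : List (Fin 5) :=
  4 :: ((List.range (d + 1)).map (fun k => gf k [3])).flatten

/-- s = g(f^{d-1}(01203)) · … · g(f(01203)) · g(01203) · abcdeacdb. -/
def s23 (d : ℕ) : List (Fin 5) :=
  ((List.range d).reverse.map (fun k => gf k [0, 1, 2, 0, 3])).flatten ++
    [0, 1, 2, 3, 4, 0, 2, 3, 1]

theorem Fw_append (u v : List (Fin 5)) : Fw (u ++ v) = Fw u ++ Fw v := by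
  simp [Fw]

theorem fword_append (u v : List (Fin 5)) : fword (u ++ v) = fword u ++ fword v := by
  simp [fword, Fw_append]

theorem gword_append (u v : List (Fin 5)) : gword (u ++ v) = gword u ++ gword v := by
  simp [gword, Fw, Gw]

theorem fword_iterate_append (k : ℕ) (u v : List (Fin 5)) :
    fword^[k] (u ++ v) = fword^[k] u ++ fword^[k] v := by
  induction k generalizing u v with
  | zero => rfl
  | succ k ih => simp only [Function.iterate_succ_apply, fword_append, ih]

theorem gf_append (k : ℕ) (u v : List (Fin 5)) : gf k (u ++ v) = gf k u ++ gf k v := by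
  simp only [gf, fword_iterate_append, gword_append]

theorem p23_succ (d : ℕ) : p23 (d + 1) = p23 d ++ gf (d + 1) [3] := by
  simp [p23, List.range_succ (n := d + 1)]

theorem s23_succ (d : ℕ) : s23 (d + 1) = gf d [0, 1, 2, 0, 3] ++ s23 d := by
  simp [s23, List.range_succ]

theorem gf_23_eq (d : ℕ) : gf d [2, 3] = s23 d ++ p23 d := by
  induction d with
  | zero => decide
  | succ d ih =>
    have h3 : gf (d + 1) [2] = gf d [0, 1, 2, 0, 3] ++ gf d [2, 3] := by
      rw [← gf_append]; rfl
    rw [show ([2, 3] : List (Fin 5)) = [2] ++ [3] from rfl, gf_append, h3, ih, s23_succ, p23_succ]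
    simp

/-- The word `3 · f(3) ⋯ f^d(3)`. -/
def leftWord : ℕ → List (Fin 5)
  | 0 => [3]
  | d + 1 => 3 :: fword (leftWord d)

/-- The word `f^{d-1}(01203) ⋯ f(01203) · 01203`. -/
def rightWord : ℕ → List (Fin 5)
  | 0 => []
  | d + 1 => fword (rightWord d) ++ [0, 1, 2, 0, 3]

theorem leftWord_succ (d : ℕ) : leftWord (d + 1) = leftWord d ++ fword^[d + 1] [3] := by
  induction d with
  | zero => rfl
  | succ d ih =>
    rw [leftWord, ih, fword_append, ← Function.iterate_succ_apply' fword (d + 1), ← ih]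
    rfl

theorem rightWord_succ (d : ℕ) :
    rightWord (d + 1) = fword^[d] [0, 1, 2, 0, 3] ++ rightWord d := by
  induction d with
  | zero => rfl
  | succ d ih =>
    rw [rightWord, ih, fword_append, ← Function.iterate_succ_apply' fword d, List.append_assoc, ← ih]
    rfl

theorem p23_eq (d : ℕ) : p23 d = 4 :: gword (leftWord d) := by
  induction d with
  | zero => rfl
  | succ d ih => rw [p23_succ, ih, leftWord_succ, gword_append]; rfl

theorem s23_eq (d : ℕ) : s23 d = gword (rightWord d) ++ [0, 1, 2, 3, 4, 0, 2, 3, 1] := by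
  induction d with
  | zero => rfl
  | succ d ih => rw [s23_succ, ih, rightWord_succ, gword_append]; simp [gf]

theorem Fw_iterate_prefix (n : ℕ) : Fw^[n] [0] <+: Fw^[n + 1] [0] := by
  induction n with
  | zero => decide
  | succ n ih =>
    obtain ⟨t, ht⟩ := ih
    rw [Function.iterate_succ_apply' Fw n, Function.iterate_succ_apply' Fw (n + 1), ← ht,
      Fw_append]
    exact List.prefix_append _ _

theorem Fw_iterate_prefix_add (n k : ℕ) : Fw^[n] [0] <+: Fw^[n + k] [0] := by
  induction k with
  | zero => exact List.prefix_rfl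
  | succ k ih => exact ih.trans (Fw_iterate_prefix (n + k))

theorem FactorF.of_infix {u v : List (Fin 5)} (h : FactorF v) (huv : u <:+: v) : FactorF u := by
  obtain ⟨n, hn⟩ := h
  exact ⟨n, huv.trans hn⟩

theorem FactorF.exists_infix_fword {u : List (Fin 5)} (h : FactorF u) :
    ∃ w, FactorF w ∧ u <:+: fword w := by
  obtain ⟨n, hn⟩ := h
  refine ⟨Fw^[n] [0], ⟨n, List.infix_rfl⟩, hn.trans ?_⟩
  have := (Fw_iterate_prefix_add n 3).isInfix
  simpa only [Function.iterate_succ_apply', fword] using this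

theorem FactorW5.exists_infix_gword {u : List (Fin 5)} (h : FactorW5 u) :
    ∃ w, FactorF w ∧ u <:+: gword w := by
  obtain ⟨n, hn⟩ := h
  refine ⟨Fw^[n] [0], ⟨n, List.infix_rfl⟩, hn.trans ?_⟩
  obtain ⟨t, ht⟩ := Fw_iterate_prefix_add n 2
  have h2 : gword (Fw^[n] [0]) = Gw (Fw^[n + 2] [0]) := by
    simp only [Function.iterate_succ_apply', gword]
  rw [h2, ← ht]
  exact ⟨[], Gw t, by simp [Gw]⟩

/-- A morphism on words with the property that `01` occurs in its images exactly at the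
beginnings of the images of letters. -/
structure IsMarked (h : List (Fin 5) → List (Fin 5)) : Prop where
  nil : h [] = []
  append : ∀ u v, h (u ++ v) = h u ++ h v
  inj : ∀ x y, h [x] = h [y] → x = y
  start : ∀ x, ∃ t, h [x] = 0 :: 1 :: t
  inner : ∀ x, ∀ s ∈ (h [x]).tails.tail, s ≠ [0] ∧ s.take 2 ≠ [0, 1]

theorem isMarked_fword : IsMarked fword where
  nil := rfl
  append := fword_append
  inj := by decide
  start x := ⟨(fword [x]).drop 2, by revert x; decide⟩
  inner := by decide

theorem isMarked_gword : IsMarked gword where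
  nil := rfl
  append := gword_append
  inj := by decide
  start x := ⟨(gword [x]).drop 2, by revert x; decide⟩
  inner := by decide

namespace IsMarked

variable {h : List (Fin 5) → List (Fin 5)}

theorem cons (hh : IsMarked h) (x : Fin 5) (w : List (Fin 5)) : h (x :: w) = h [x] ++ h w :=
  hh.append [x] w

theorem eq_nil_or_start (hh : IsMarked h) (w : List (Fin 5)) :
    h w = [] ∨ ∃ t, h w = 0 :: 1 :: t := by
  cases w with
  | nil => exact .inl hh.nil
  | cons x w =>
    obtain ⟨t, ht⟩ := hh.start x
    exact .inr ⟨t ++ h w, by rw [hh.cons, ht]; rfl⟩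

theorem append_start (hh : IsMarked h) (u B : List (Fin 5)) :
    ∃ C, h u ++ 0 :: 1 :: B = 0 :: 1 :: C := by
  rcases hh.eq_nil_or_start u with hu | ⟨t, hu⟩ <;> simp [hu]

theorem not_start (hh : IsMarked h) {x : Fin 5} {a s r B : List (Fin 5)} (hx : h [x] = a ++ s)
    (ha : a ≠ []) (hs : s ≠ []) : s ++ r ≠ 0 :: 1 :: B := by
  have hm : s ∈ (h [x]).tails.tail := by
    cases a with
    | nil => exact absurd rfl ha
    | cons c a =>
      rw [hx]
      simp
  obtain ⟨h1, h2⟩ := hh.inner x s hm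
  intro he
  match s, hs with
  | [c], _ => simp_all
  | c :: c' :: s, _ => simp_all

theorem split (hh : IsMarked h) {w A B : List (Fin 5)} (e : h w = A ++ 0 :: 1 :: B) :
    ∃ w₁ w₂, w = w₁ ++ w₂ ∧ h w₁ = A ∧ h w₂ = 0 :: 1 :: B := by
  induction w generalizing A with
  | nil => simp [hh.nil] at e
  | cons x w ih =>
    by_cases hA : A = []
    · subst hA
      exact ⟨[], x :: w, rfl, hh.nil, e⟩
    · have e' := e
      rw [hh.cons, List.append_eq_append_iff] at e'
      rcases e' with ⟨a, rfl, ha⟩ | ⟨s, hs, hr⟩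
      · obtain ⟨w₁, w₂, rfl, h1, h2⟩ := ih ha
        exact ⟨x :: w₁, w₂, rfl, by rw [hh.cons, h1], h2⟩
      · by_cases hs0 : s = []
        · subst hs0
          exact ⟨[x], w, rfl, by simpa using hs, by simpa using hr.symm⟩
        · exact absurd hr.symm (hh.not_start hs hA hs0)

theorem letter_eq (hh : IsMarked h) {x y : Fin 5} {w B : List (Fin 5)}
    (e : h (y :: w) = h [x] ++ 0 :: 1 :: B) : x = y ∧ h w = 0 :: 1 :: B := by
  have hne (z : Fin 5) : h [z] ≠ [] := by
    obtain ⟨t, ht⟩ := hh.start z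
    simp [ht]
  rw [hh.cons, List.append_eq_append_iff] at e
  rcases e with ⟨s, hs, hr⟩ | ⟨s, hs, hr⟩
  · by_cases hs0 : s = []
    · subst hs0
      exact ⟨hh.inj _ _ (by simpa using hs), by simpa using hr⟩
    · exfalso
      rcases hh.eq_nil_or_start w with hw | ⟨t, ht⟩
      · simp [hw, hs0] at hr
      · exact hh.not_start hs (hne y) hs0 (hr.symm.trans ht)
  · by_cases hs0 : s = []
    · subst hs0
      exact ⟨(hh.inj _ _ (by simpa using hs)).symm, by simpa using hr.symm⟩
    · exact absurd hr.symm (hh.not_start hs (hne x) hs0)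

theorem parse (hh : IsMarked h) {u w B : List (Fin 5)} (e : h w = h u ++ 0 :: 1 :: B) :
    ∃ w', w = u ++ w' ∧ h w' = 0 :: 1 :: B := by
  induction u generalizing w with
  | nil => exact ⟨w, rfl, by simpa [hh.nil] using e⟩
  | cons x u ih =>
    cases w with
    | nil => simp [hh.nil] at e
    | cons y w =>
      obtain ⟨C, hC⟩ := hh.append_start u B
      rw [hh.cons x, List.append_assoc, hC] at e
      obtain ⟨rfl, hw⟩ := hh.letter_eq e
      obtain ⟨w', rfl, h'⟩ := ih (hw.trans hC.symm)
      exact ⟨w', rfl, h'⟩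

/-- An occurrence of `h(u)` followed by `01` inside `h(w)` comes from an occurrence of `u`. -/
theorem desubstitute (hh : IsMarked h) {u w A B : List (Fin 5)}
    (e : h w = A ++ (h u ++ 0 :: 1 :: B)) :
    ∃ w₁ w₂, w = w₁ ++ (u ++ w₂) ∧ h w₁ = A ∧ h w₂ = 0 :: 1 :: B := by
  obtain ⟨C, hC⟩ := hh.append_start u B
  obtain ⟨w₁, w₂, rfl, h1, h2⟩ := hh.split (e.trans (congrArg (A ++ ·) hC))
  obtain ⟨w', rfl, h'⟩ := hh.parse (h2.trans hC.symm)
  exact ⟨w₁, w', rfl, h1, h'⟩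

end IsMarked

theorem fword_letters : fword [0] = [0, 1, 2, 0, 3] ∧ fword [1] = [0, 1, 2, 4] ∧
    fword [2] = [0, 1, 2, 0, 3, 2, 3] ∧ fword [3] = [0, 1, 2, 4, 0, 3, 2, 4] ∧
    fword [4] = [0, 1, 2, 4, 0, 3, 2, 3] := by decide

theorem gword_letters : gword [0] = [0, 1, 2, 3, 4, 0, 2, 3] ∧
    gword [1] = [0, 1, 2, 3, 1, 4, 2, 3] ∧
    gword [2] = [0, 1, 2, 3, 4, 0, 2, 3, 1, 4] ∧
    gword [3] = [0, 1, 2, 3, 1, 4, 2, 3, 4, 0, 2, 3, 1, 4, 2, 3] ∧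
    gword [4] = [0, 1, 2, 3, 1, 4, 2, 3, 4, 0, 2, 3, 1, 4] := by decide

theorem exists_eq_two_cons_of_gword {w B : List (Fin 5)}
    (e : gword w = 0 :: 1 :: 2 :: 3 :: 4 :: 0 :: 2 :: 3 :: 1 :: B) : ∃ w', w = 2 :: w' := by
  obtain ⟨g0, g1, g2, g3, g4⟩ := gword_letters
  cases w with
  | nil => simp [isMarked_gword.nil] at e
  | cons y w =>
    rw [isMarked_gword.cons] at e
    rcases isMarked_gword.eq_nil_or_start w with hw | ⟨t, hw⟩ <;>
      fin_cases y <;> simp_all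

theorem exists_eq_two_cons_of_fword {w B : List (Fin 5)}
    (e : fword w = 0 :: 1 :: 2 :: 0 :: 3 :: 2 :: B) : ∃ w', w = 2 :: w' := by
  obtain ⟨f0, f1, f2, f3, f4⟩ := fword_letters
  cases w with
  | nil => simp [isMarked_fword.nil] at e
  | cons y w =>
    rw [isMarked_fword.cons] at e
    rcases isMarked_fword.eq_nil_or_start w with hw | ⟨t, hw⟩ <;>
      fin_cases y <;> simp_all

theorem exists_eq_concat_of_gword {w A : List (Fin 5)} (e : gword w = A ++ [4]) :
    ∃ w' x, w = w' ++ [x] ∧ (x = 2 ∨ x = 4) := by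
  rcases List.eq_nil_or_concat w with rfl | ⟨w', x, rfl⟩
  · simp [isMarked_gword.nil] at e
  · refine ⟨w', x, by simp, ?_⟩
    have hl := congrArg List.getLast? e
    rw [List.concat_eq_append, gword_append] at hl
    obtain ⟨g0, g1, g2, g3, g4⟩ := gword_letters
    fin_cases x <;> simp_all

theorem exists_eq_concat_of_fword {w A : List (Fin 5)} {z : Fin 5} (hz : z = 2 ∨ z = 4)
    (e : fword w = A ++ [z, 3]) : ∃ w' x, w = w' ++ [x] ∧ (x = 2 ∨ x = 4) := by
  rcases List.eq_nil_or_concat w with rfl | ⟨w', x, rfl⟩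
  · simp [isMarked_fword.nil] at e
  · refine ⟨w', x, by simp, ?_⟩
    have hl := congrArg (fun l => l.reverse.take 2) e
    rw [List.concat_eq_append, fword_append] at hl
    obtain ⟨f0, f1, f2, f3, f4⟩ := fword_letters
    fin_cases x <;> rcases hz with rfl | rfl <;> simp_all

theorem not_infix_fword {z : Fin 5} (hz : z = 2 ∨ z = 4) (w : List (Fin 5)) :
    ¬ [z, 3, 2] <:+: fword w := by
  obtain ⟨f0, f1, f2, f3, f4⟩ := fword_letters
  induction w with
  | nil => simp [isMarked_fword.nil]
  | cons x w ih =>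
    rw [isMarked_fword.cons]
    rcases isMarked_fword.eq_nil_or_start w with hw | ⟨t, hw⟩ <;> rw [hw] at ih ⊢ <;>
      fin_cases x <;> rcases hz with rfl | rfl <;>
      simp_all [List.infix_cons_iff]

theorem not_factorF_leftWord_rightWord (d : ℕ) {z : Fin 5} (hz : z = 2 ∨ z = 4) :
    ¬ FactorF ([z] ++ (leftWord d ++ rightWord d ++ [2])) := by
  induction d generalizing z with
  | zero =>
    intro hF
    obtain ⟨w, -, hw⟩ := hF.exists_infix_fword
    exact not_infix_fword hz w hw
  | succ d ih =>
    intro hF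
    obtain ⟨w, hwF, A, B, hw⟩ := hF.exists_infix_fword
    have e : fword w = (A ++ [z, 3]) ++
        (fword (leftWord d ++ rightWord d) ++ 0 :: 1 :: (2 :: 0 :: 3 :: 2 :: B)) := by
      rw [← hw, leftWord, rightWord, fword_append]
      simp
    obtain ⟨w₁, w₂, rfl, h1, h2⟩ := isMarked_fword.desubstitute e
    obtain ⟨w₁, x, rfl, hx⟩ := exists_eq_concat_of_fword hz h1
    obtain ⟨w₂, rfl⟩ := exists_eq_two_cons_of_fword h2
    exact ih hx (hwF.of_infix ⟨w₁, w₂, by simp⟩)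

theorem not_factorW5_p23_s23 (d : ℕ) : ¬ FactorW5 (p23 d ++ s23 d) := by
  intro hF
  obtain ⟨w, hwF, A, B, hw⟩ := hF.exists_infix_gword
  have e : gword w = (A ++ [4]) ++ (gword (leftWord d ++ rightWord d) ++
      0 :: 1 :: (2 :: 3 :: 4 :: 0 :: 2 :: 3 :: 1 :: B)) := by
    rw [← hw, p23_eq, s23_eq, gword_append]
    simp
  obtain ⟨w₁, w₂, rfl, h1, h2⟩ := isMarked_gword.desubstitute e
  obtain ⟨w₁, x, rfl, hx⟩ := exists_eq_concat_of_gword h1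
  obtain ⟨w₂, rfl⟩ := exists_eq_two_cons_of_gword h2
  exact not_factorF_leftWord_rightWord d hx (hwF.of_infix ⟨w₁, w₂, by simp⟩)

theorem conj_gf_23_not_factor (d : ℕ) :
    Conj (gf d [2, 3]) (p23 d ++ s23 d) ∧ ¬ FactorW5 (p23 d ++ s23 d) :=
  ⟨⟨s23 d, p23 d, gf_23_eq d, rfl⟩, not_factorW5_p23_s23 d⟩
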